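/- Every caterpillar is antimagic: if C is a tree of order n ≥ 3 whose non-leaf vertices induce a path, then there exists a bijection φ : E(C) → {1,…,n−1} such that all vertex sums are pairwise distinct. -/

import Mathlib

open SimpleGraph Finset
open scoped Classical

/-- Among all assignments of the labels in `L` to the elements of `X`, one maximising the sum of
the squares of the group totals has pairwise distinct totals. -/
lemma exists_equiv_group_totals_ne {X : Type*} [Fintype X] (g : X → ℕ) (B : ℕ → ℕ)
    (L : Finset ℕ) (hL : Fintype.card X = #L) :
    ∃ e : X ≃ L, ∀ x y, g x ≠ g y →
      B (g x) + ∑ z with g z = g x, (e z : ℕ) ≠ B (g y) + ∑ z with g z = g y, (e z : ℕ) := by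
  let T : (X ≃ L) → ℕ → ℤ := fun e j ↦ B j + ∑ z with g z = j, (e z : ℤ)
  have : Nonempty (X ≃ L) := ⟨Fintype.equivOfCardEq (by simpa using hL)⟩
  obtain ⟨e, he⟩ := Finite.exists_max fun e : X ≃ L ↦ ∑ j ∈ univ.image g, T e j ^ 2
  refine ⟨e, fun x y hxy heq ↦ ?_⟩
  have hT : T e (g x) = T e (g y) := by simp only [T]; exact_mod_cast heq
  set d : ℤ := (e y : ℤ) - e x with hd
  have hne : x ≠ y := fun h ↦ hxy (h ▸ rfl)
  have hd0 : d ≠ 0 := by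
    intro h
    apply hne
    apply e.injective
    apply Subtype.ext
    have : (e y : ℤ) = e x := by linarith
    exact_mod_cast this.symm
  have hswap : ∀ j, T ((Equiv.swap x y).trans e) j =
      T e j + ((if g x = j then d else 0) - (if g y = j then d else 0)) := by
    intro j
    have hpt : ∀ z, (((Equiv.swap x y).trans e z : ℕ) : ℤ) =
        (e z : ℤ) + ((if z = x then d else 0) - (if z = y then d else 0)) := by
      intro z
      rw [Equiv.trans_apply, Equiv.swap_apply_def]
      split_ifs <;> simp_all
    simp only [T, hpt, sum_add_distrib, sum_sub_distrib, sum_ite_eq', mem_filter, mem_univ,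
      true_and]
    ring
  have h := he ((Equiv.swap x y).trans e)
  simp only [hswap] at h
  have hexp : ∀ j, (T e j + ((if g x = j then d else 0) - (if g y = j then d else 0))) ^ 2 =
      T e j ^ 2 + ((if g x = j then 2 * T e j * d + d ^ 2 else 0) +
        (if g y = j then - 2 * T e j * d + d ^ 2 else 0)) := by
    intro j
    split_ifs with h1 h2
    · exact absurd (h1.trans h2.symm) hxy
    all_goals ring
  simp only [hexp, sum_add_distrib, sum_ite_eq, mem_image, mem_univ, true_and,
    exists_apply_eq_apply, if_true, hT] at h
  have : 0 < d ^ 2 := by positivity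
  linarith

/-- The increasing sequence of small labels on the path: the label following the `u`-th one is
skipped when some vertex `j` in `S`, lying between the path labels of index `j / 2` and
`(j + 1) / 2`, has relative sum `u`. -/
noncomputable def smallLabel (S : ℕ → Prop) : ℕ → ℕ
  | 0 => 0
  | u + 1 => smallLabel S u +
      if ∃ t : Fin (u + 1), (S (2 * t) ∧ smallLabel S t + t = u) ∨
        (S (2 * t - 1) ∧ 1 ≤ (t : ℕ) ∧ smallLabel S t + t = u + 1) then 2 else 1

/-- The sum of the two path labels at the `j`-th path vertex, up to a constant. -/
noncomputable def relSum (S : ℕ → Prop) (j : ℕ) : ℕ := smallLabel S ((j + 1) / 2) + j / 2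

lemma smallLabel_zero (S : ℕ → Prop) : smallLabel S 0 = 0 := by rw [smallLabel]

lemma smallLabel_strictMono (S : ℕ → Prop) : StrictMono (smallLabel S) := by
  refine strictMono_nat_of_lt_succ fun u ↦ ?_
  rw [smallLabel]
  split_ifs <;> omega

lemma relSum_strictMono (S : ℕ → Prop) : StrictMono (relSum S) := by
  refine strictMono_nat_of_lt_succ fun j ↦ ?_
  unfold relSum
  obtain ⟨t, rfl | rfl⟩ := Nat.even_or_odd' j
  · have := smallLabel_strictMono S (Nat.lt_succ_self t)
    rw [show (2 * t + 1) / 2 = t by omega, show 2 * t / 2 = t by omega,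
      show (2 * t + 1 + 1) / 2 = t + 1 by omega]
    simpa using this
  · rw [show (2 * t + 1 + 1) / 2 = t + 1 by omega, show (2 * t + 1) / 2 = t by omega,
      show (2 * t + 1 + 1 + 1) / 2 = t + 1 by omega]
    omega

lemma smallLabel_succ (S : ℕ → Prop) (u : ℕ) :
    smallLabel S (u + 1) = smallLabel S u + if ∃ j, S j ∧ relSum S j = u then 2 else 1 := by
  rw [smallLabel]
  congr 1
  refine if_congr ⟨?_, ?_⟩ rfl rfl
  · rintro ⟨t, ⟨hS, h⟩ | ⟨hS, h1, h⟩⟩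
    · refine ⟨_, hS, ?_⟩
      rw [relSum, show (2 * (t : ℕ) + 1) / 2 = t by omega, show 2 * (t : ℕ) / 2 = t by omega, h]
    · refine ⟨_, hS, ?_⟩
      rw [relSum, show (2 * (t : ℕ) - 1 + 1) / 2 = t by omega]
      omega
  · rintro ⟨j, hS, h⟩
    have hle := (smallLabel_strictMono S).le_apply (x := (j + 1) / 2)
    unfold relSum at h
    obtain ⟨t, rfl | rfl⟩ := Nat.even_or_odd' j
    · rw [show (2 * t + 1) / 2 = t by omega, show 2 * t / 2 = t by omega] at *
      exact ⟨⟨t, by omega⟩, Or.inl ⟨hS, h⟩⟩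
    · rw [show (2 * t + 1 + 1) / 2 = t + 1 by omega, show (2 * t + 1) / 2 = t by omega] at *
      exact ⟨⟨t + 1, by omega⟩, Or.inr ⟨hS, by simp, by simp only; omega⟩⟩

lemma smallLabel_eq_add_card (S : ℕ → Prop) (n : ℕ) :
    smallLabel S n = n + #{u ∈ range n | ∃ j, S j ∧ relSum S j = u} := by
  induction n with
  | zero => simp [smallLabel_zero]
  | succ n ih =>
    rw [smallLabel_succ, range_add_one, filter_insert, ih]
    split_ifs with h
    · rw [card_insert_of_notMem (by simp)]; ring
    · ring

/-- A labelling of the path with edges `z 1, …, z (2 * p)` and of pendant edges `x : X`, attached to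
the path vertices `g x`, for which all vertex sums are distinct. -/
lemma exists_path_labels {X : Type*} [Fintype X] {p : ℕ} (hp : 0 < p) (g : X → ℕ) :
    ∃ (z : ℕ → ℕ) (f : X → ℕ), z 0 = 0 ∧ Set.InjOn z (Set.Icc 1 (2 * p)) ∧
      (∀ j ∈ Set.Icc 1 (2 * p), z j ∈ Set.Icc 1 (2 * p + Fintype.card X)) ∧
      Function.Injective f ∧ (∀ x, f x ∈ Set.Icc 1 (2 * p + Fintype.card X)) ∧
      (∀ j ∈ Set.Icc 1 (2 * p), ∀ x, z j ≠ f x) ∧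
      Set.InjOn (fun j ↦ z j + z (j + 1) + ∑ x with g x = j, f x) (Set.Iio (2 * p)) ∧
      ∀ j < 2 * p, (∀ x, z j + z (j + 1) + (∑ y with g y = j, f y) ≠ f x) ∧
        z j + z (j + 1) + (∑ y with g y = j, f y) ≠ z (2 * p) := by
  set S : ℕ → Prop := fun j ↦ #{x | g x = j} = 1
  set a := smallLabel S with ha
  set v := relSum S with hv
  set N := p + Fintype.card X with hN
  let Q : ℕ → Prop := fun j ↦ S j ∧ v j < p
  have a0 : a 0 = 0 := smallLabel_zero S
  have amono : StrictMono a := smallLabel_strictMono S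
  have vmono : StrictMono v := relSum_strictMono S
  have a_le : ∀ n, n ≤ a n := fun n ↦ amono.le_apply
  have v_even : ∀ t, v (2 * t) = a t + t := fun t ↦ by
    rw [hv, relSum, show (2 * t + 1) / 2 = t by omega, show 2 * t / 2 = t by omega]
  have v_odd : ∀ t, v (2 * t + 1) = a (t + 1) + t := fun t ↦ by
    rw [hv, relSum, show (2 * t + 1 + 1) / 2 = t + 1 by omega, show (2 * t + 1) / 2 = t by omega]
  have a_skip : ∀ j, S j → a (v j + 1) = a (v j) + 2 := fun j hj ↦ by
    rw [ha, smallLabel_succ, if_pos ⟨j, hj, rfl⟩]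
  have S_unique : ∀ x y, S (g x) → g x = g y → x = y := fun x y hx hxy ↦
    (card_eq_one.1 hx).elim fun w hw ↦ by
      have h1 : x ∈ ({w} : Finset X) := hw ▸ by simp
      have h2 : y ∈ ({w} : Finset X) := hw ▸ by simp [hxy]
      rw [mem_singleton] at h1 h2
      rw [h1, h2]
  have hcard : a p = p + #{x | Q (g x)} := by
    rw [ha, smallLabel_eq_add_card]
    congr 1
    symm
    refine card_bij (fun x _ ↦ v (g x)) ?_ ?_ ?_
    · intro x hx
      simp only [mem_filter, mem_univ, true_and, mem_range] at hx ⊢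
      exact ⟨hx.2, _, hx.1, rfl⟩
    · intro x hx y _ hxy
      simp only [mem_filter, mem_univ, true_and] at hx
      exact S_unique x y hx.1 (vmono.injective hxy)
    · intro u hu
      simp only [mem_filter, mem_univ, true_and, mem_range] at hu ⊢
      obtain ⟨hu, j, hj, rfl⟩ := hu
      obtain ⟨x, hx⟩ := card_eq_one.1 hj
      have hxj : x ∈ ({x} : Finset X) := mem_singleton_self x
      rw [← hx, mem_filter] at hxj
      obtain ⟨-, rfl⟩ := hxj
      exact ⟨x, ⟨hj, hu⟩, rfl⟩
  have hcard' : #{x | Q (g x)} + Fintype.card {x // ¬ Q (g x)} = Fintype.card X := by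
    rw [Fintype.card_subtype, card_filter_add_card_filter_not, card_univ]
  have aN : a p ≤ N := by omega
  obtain ⟨e, he⟩ := exists_equiv_group_totals_ne (fun x : {x // ¬ Q (g x)} ↦ g x)
    (fun j ↦ N + 1 + v j) (Ioc (a p) N) (by rw [Nat.card_Ioc]; omega)
  let f : X → ℕ := fun x ↦ if h : Q (g x) then a (v (g x)) + 1 else e ⟨x, h⟩
  let z : ℕ → ℕ := fun j ↦ if Even j then a (j / 2) else N + j / 2 + 1
  have f_pos : ∀ x, Q (g x) → f x = a (v (g x)) + 1 := fun x hx ↦ dif_pos hx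
  have f_neg : ∀ x (hx : ¬ Q (g x)), f x = e ⟨x, hx⟩ := fun x hx ↦ dif_neg hx
  have z_even : ∀ t, z (2 * t) = a t := fun t ↦ by
    simp only [z, if_pos (even_two_mul t)]; congr 1; omega
  have z_odd : ∀ t, z (2 * t + 1) = N + t + 1 := fun t ↦ by
    simp only [z, if_neg (Nat.not_even_two_mul_add_one t)]; omega
  have base : ∀ j, z j + z (j + 1) = N + 1 + v j := by
    intro j
    obtain ⟨t, rfl | rfl⟩ := Nat.even_or_odd' j
    · rw [z_even, z_odd, v_even]; ring
    · rw [z_odd, show 2 * t + 1 + 1 = 2 * (t + 1) by ring, z_even, v_odd]; ring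
  have e_mem : ∀ x, a p < (e x : ℕ) ∧ (e x : ℕ) ≤ N := fun x ↦ mem_Ioc.1 (e x).2
  have f_lt : ∀ x, Q (g x) → f x < a p := fun x hx ↦ by
    have h1 := a_skip _ hx.1
    have h2 := amono.monotone (Nat.succ_le_of_lt hx.2)
    rw [f_pos x hx]; simp only [Nat.succ_eq_add_one] at h2; omega
  have f_gt : ∀ x, ¬ Q (g x) → a p < f x := fun x hx ↦ f_neg x hx ▸ (e_mem _).1
  have f_le : ∀ x, 1 ≤ f x ∧ f x ≤ N := fun x ↦ by
    by_cases hx : Q (g x)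
    · have := f_lt x hx; have := f_pos x hx; omega
    · have := f_gt x hx; have := e_mem ⟨x, hx⟩; have := f_neg x hx; omega
  have a_ne_f : ∀ t ≤ p, ∀ x, a t ≠ f x := by
    intro t ht x
    by_cases hx : Q (g x)
    · rw [f_pos x hx]
      intro h
      have h1 : v (g x) < t := amono.lt_iff_lt.1 (by omega)
      have h2 := amono.monotone (Nat.succ_le_of_lt h1)
      have h3 := a_skip _ hx.1
      simp only [Nat.succ_eq_add_one] at h2; omega
    · have := f_gt x hx
      have := amono.monotone ht
      omega
  have sum_pos : ∀ x, Q (g x) → ∑ y with g y = g x, f y = f x := fun x hx ↦ by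
    rw [show ({y | g y = g x} : Finset X) = {x} from ?_, sum_singleton]
    ext y
    simp only [mem_filter, mem_univ, true_and, mem_singleton]
    exact ⟨fun h ↦ (S_unique x y hx.1 h.symm).symm, fun h ↦ h ▸ rfl⟩
  have sum_neg : ∀ j, ¬ Q j → ∑ y with g y = j, f y =
      ∑ y ∈ ({y | g y = j} : Finset {x // ¬ Q (g x)}), (e y : ℕ) := fun j hj ↦ by
    symm
    refine sum_bij (fun y _ ↦ y.1) (by simp) (fun _ _ _ _ h ↦ Subtype.ext h) ?_ ?_
    · intro y hy
      simp only [mem_filter, mem_univ, true_and] at hy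
      exact ⟨⟨y, hy ▸ hj⟩, by simpa using hy, rfl⟩
    · intro y _
      rw [f_neg y y.2]
  have v_last : v (2 * p - 1) = a p + p - 1 := by
    obtain ⟨q, rfl⟩ : ∃ q, p = q + 1 := ⟨p - 1, by omega⟩
    rw [show 2 * (q + 1) - 1 = 2 * q + 1 by omega, v_odd]; rfl
  have v_lt : ∀ j < 2 * p, v j < a p + p := fun j hj ↦ by
    have := vmono.monotone (show j ≤ 2 * p - 1 by omega)
    omega
  -- the relative total of a vertex in `Q` lies strictly between two consecutive values of `v`
  have tot_pos : ∀ x, Q (g x) → v (g x) + f x = v (2 * v (g x)) + 1 ∧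
      v (g x) + f x + 1 = v (2 * v (g x) + 1) := fun x hx ↦ by
    rw [f_pos x hx, v_even, v_odd, a_skip _ hx.1]; omega
  have tot_pos_lt : ∀ x, Q (g x) → v (g x) + f x < a p + p := fun x hx ↦ by
    have := v_lt (2 * v (g x) + 1) (by have := hx.2; omega)
    have := tot_pos x hx
    omega
  have tot_neg : ∀ x, ¬ Q (g x) → a p + p < v (g x) + ∑ y with g y = g x, f y := fun x hx ↦ by
    have hxf := f_gt x hx
    by_cases hv : v (g x) < p
    · have hS' : ¬ S (g x) := fun h ↦ hx ⟨h, hv⟩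
      obtain ⟨y, hy, hyx⟩ := exists_mem_ne (s := ({y | g y = g x} : Finset X))
        (lt_of_le_of_ne (card_pos.2 ⟨x, by simp⟩) (Ne.symm hS')) x
      have hsub : ({x, y} : Finset X) ⊆ ({y | g y = g x} : Finset X) := by
        intro w hw
        simp only [mem_insert, mem_singleton] at hw
        rcases hw with rfl | rfl
        · simp
        · exact hy
      have h1 := sum_le_sum_of_subset (f := f) hsub
      rw [sum_pair hyx.symm] at h1
      have h2 := f_gt y (by rw [(mem_filter.1 hy).2]; exact hx)
      have := a_le p
      omega
    · have h1 := single_le_sum (f := f) (fun _ _ ↦ Nat.zero_le _)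
        (show x ∈ ({y | g y = g x} : Finset X) by simp)
      omega
  have sum_eq_zero_or : ∀ j, (∑ y with g y = j, f y = 0) ∨ ∃ x, g x = j := by
    intro j
    by_cases h : ∃ x, g x = j
    · exact Or.inr h
    · left
      refine sum_eq_zero fun x hx ↦ absurd ⟨x, (mem_filter.1 hx).2⟩ h
  refine ⟨z, f, ?_, ?_, ?_, ?_, ?_, ?_, ?_, ?_⟩
  · exact (z_even 0).trans a0
  · intro i hi j hj hij
    simp only [Set.mem_Icc] at hi hj
    obtain ⟨s, rfl | rfl⟩ := Nat.even_or_odd' i <;> obtain ⟨t, rfl | rfl⟩ := Nat.even_or_odd' j <;>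
      simp only [z_even, z_odd] at hij
    · rw [amono.injective hij]
    · have := amono.monotone (show s ≤ p by omega); omega
    · have := amono.monotone (show t ≤ p by omega); omega
    · omega
  · intro j hj
    simp only [Set.mem_Icc] at hj ⊢
    obtain ⟨t, rfl | rfl⟩ := Nat.even_or_odd' j
    · rw [z_even]
      have := amono.monotone (show t ≤ p by omega)
      have := a_le t
      omega
    · rw [z_odd]; omega
  · intro x y hxy
    by_cases hx : Q (g x) <;> by_cases hy : Q (g y)
    · rw [f_pos x hx, f_pos y hy] at hxy
      exact S_unique x y hx.1 (vmono.injective (amono.injective (by omega)))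
    · have := f_lt x hx; have := f_gt y hy; omega
    · have := f_gt x hx; have := f_lt y hy; omega
    · rw [f_neg x hx, f_neg y hy] at hxy
      exact congrArg Subtype.val (e.injective (Subtype.ext hxy))
  · intro x
    have := f_le x
    simp only [Set.mem_Icc]; omega
  · intro j hj x
    simp only [Set.mem_Icc] at hj
    obtain ⟨t, rfl | rfl⟩ := Nat.even_or_odd' j
    · rw [z_even]; exact a_ne_f t (by omega) x
    · rw [z_odd]; have := f_le x; omega
  · -- the sum at a vertex without pendant edges differs from that at any vertex with some
    have light : ∀ j < 2 * p, ∀ x, v j ≠ v (g x) + ∑ y with g y = g x, f y := by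
      intro j hj x h
      by_cases hx : Q (g x)
      · rw [sum_pos x hx] at h
        have h1 := tot_pos x hx
        have h2 : 2 * v (g x) < j := vmono.lt_iff_lt.1 (by omega)
        have h3 : j < 2 * v (g x) + 1 := vmono.lt_iff_lt.1 (by omega)
        omega
      · have := tot_neg x hx; have := v_lt j hj; omega
    intro i hi j hj hij
    simp only [Set.mem_Iio] at hi hj
    simp only [base] at hij
    rcases sum_eq_zero_or i with h1 | ⟨x, rfl⟩ <;> rcases sum_eq_zero_or j with h2 | ⟨y, rfl⟩
    · rw [h1, h2] at hij; exact vmono.injective (by omega)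
    · exact absurd (by omega) (light i hi y)
    · exact absurd (by omega) (light j hj x)
    · by_cases hx : Q (g x) <;> by_cases hy : Q (g y)
      · rw [sum_pos x hx, sum_pos y hy] at hij
        have h1 := tot_pos x hx
        have h2 := tot_pos y hy
        have h3 := vmono.injective (show v (2 * v (g x)) = v (2 * v (g y)) by omega)
        exact vmono.injective (by omega)
      · have := tot_pos_lt x hx; have := tot_neg y hy; rw [sum_pos x hx] at hij; omega
      · have := tot_pos_lt y hy; have := tot_neg x hx; rw [sum_pos y hy] at hij; omega
      · by_contra hne
        rw [sum_neg _ hx, sum_neg _ hy] at hij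
        exact he ⟨x, hx⟩ ⟨y, hy⟩ hne hij
  · intro j _
    rw [base, show z (2 * p) = a p from z_even p]
    exact ⟨fun x ↦ by have := f_le x; omega, by omega⟩

/-- If the vertices of `G` are those of an induced path with `2 * p` edges together with pendant
vertices attached to the path vertices other than the last one, then `G` is antimagic. -/
lemma exists_antimagic_of_even_path {V : Type*} [Fintype V] (G : SimpleGraph V) {p : ℕ}
    (hp : 0 < p) (W : ℕ → V) (hW : Set.InjOn W (Set.Iic (2 * p)))
    (hadj : ∀ i ≤ 2 * p, ∀ j ≤ 2 * p, G.Adj (W i) (W j) ↔ i + 1 = j ∨ j + 1 = i)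
    (hpend : ∀ x, (∀ j ≤ 2 * p, W j ≠ x) → ∃ j < 2 * p, ∀ y, G.Adj x y ↔ y = W j) :
    ∃ φ : Sym2 V → ℕ,
      Set.BijOn φ G.edgeSet (Set.Icc 1 (Fintype.card V - 1)) ∧
      ∀ u v : V, u ≠ v →
        (∑ e ∈ G.edgeFinset.filter (fun e => u ∈ e), φ e) ≠
        (∑ e ∈ G.edgeFinset.filter (fun e => v ∈ e), φ e) := by
  let X := {x // ∀ j ≤ 2 * p, W j ≠ x}
  have hpend' : ∀ x : X, ∃ j < 2 * p, ∀ y, G.Adj x.1 y ↔ y = W j := fun x ↦ hpend x.1 x.2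
  choose g hg hgadj using hpend'
  obtain ⟨z, f, z0, z_inj, z_mem, f_inj, f_mem, z_ne_f, tot_inj, tot_ne⟩ :=
    exists_path_labels hp g
  have W_inj : ∀ i ≤ 2 * p, ∀ j ≤ 2 * p, W i = W j → i = j := fun i hi j hj h ↦ hW hi hj h
  have W_ne : ∀ j ≤ 2 * p, ∀ x : X, W j ≠ x.1 := fun j hj x ↦ x.2 j hj
  have vertex_cases : ∀ u, (∃ j ≤ 2 * p, W j = u) ∨ ∃ x : X, x.1 = u := by
    intro u
    by_cases h : ∃ j ≤ 2 * p, W j = u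
    · exact Or.inl h
    · push Not at h
      exact Or.inr ⟨⟨u, h⟩, rfl⟩
  let E : Fin (2 * p) ⊕ X → Sym2 V :=
    Sum.elim (fun i ↦ s(W i, W (i + 1))) (fun x ↦ s(x.1, W (g x)))
  let L : Fin (2 * p) ⊕ X → ℕ := Sum.elim (fun i ↦ z (i + 1)) f
  have mem_path : ∀ i < 2 * p, ∀ j ≤ 2 * p, W j ∈ s(W i, W (i + 1)) ↔ i = j ∨ i + 1 = j := by
    intro i hi j hj
    rw [Sym2.mem_iff]
    constructor
    · rintro (h | h)
      · exact Or.inl (W_inj _ hj _ (by omega) h).symm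
      · exact Or.inr (W_inj _ hj _ (by omega) h).symm
    · rintro (rfl | rfl) <;> simp
  have mem_path' : ∀ i < 2 * p, ∀ x : X, x.1 ∉ s(W i, W (i + 1)) := by
    intro i hi x h
    rcases Sym2.mem_iff.1 h with h | h
    · exact W_ne i (by omega) x h.symm
    · exact W_ne (i + 1) (by omega) x h.symm
  have mem_pend : ∀ x : X, ∀ j ≤ 2 * p, W j ∈ s(x.1, W (g x)) ↔ g x = j := by
    intro x j hj
    rw [Sym2.mem_iff]
    refine ⟨fun h ↦ ?_, fun h ↦ Or.inr (h ▸ rfl)⟩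
    rcases h with h | h
    · exact absurd h (W_ne j hj x)
    · exact (W_inj _ hj _ (hg x).le h).symm
  have mem_pend' : ∀ x y : X, y.1 ∈ s(x.1, W (g x)) ↔ x = y := by
    intro x y
    rw [Sym2.mem_iff]
    refine ⟨fun h ↦ ?_, fun h ↦ Or.inl (h ▸ rfl)⟩
    rcases h with h | h
    · exact (Subtype.ext h).symm
    · exact absurd h.symm (W_ne _ (hg x).le y)
  have E_inj : Function.Injective E := by
    rintro (i | x) (j | y) h
    · change s(W i, W (i + 1)) = s(W j, W (j + 1)) at h
      have h1 := (mem_path j j.2 i i.2.le).1 (h ▸ Sym2.mem_mk_left _ _)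
      have h2 := (mem_path i i.2 j j.2.le).1 (h ▸ Sym2.mem_mk_left _ _)
      exact congrArg Sum.inl (Fin.ext (by omega))
    · exact absurd (show y.1 ∈ s(W i, W (i + 1)) from
        (show s(W i, W (i + 1)) = s(y.1, W (g y)) from h) ▸ Sym2.mem_mk_left _ _)
        (mem_path' i i.2 y)
    · exact absurd (show x.1 ∈ s(W j, W (j + 1)) from
        (show s(x.1, W (g x)) = s(W j, W (j + 1)) from h) ▸ Sym2.mem_mk_left _ _)
        (mem_path' j j.2 x)
    · exact congrArg Sum.inr ((mem_pend' x y).1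
        ((show s(x.1, W (g x)) = s(y.1, W (g y)) from h) ▸ Sym2.mem_mk_left _ _))
  have L_inj : Function.Injective L := by
    rintro (i | x) (j | y) h
    · have := z_inj (Set.mem_Icc.2 ⟨by omega, i.2⟩) (Set.mem_Icc.2 ⟨by omega, j.2⟩) h
      exact congrArg Sum.inl (Fin.ext (by omega))
    · exact absurd h (z_ne_f _ (Set.mem_Icc.2 ⟨by omega, i.2⟩) y)
    · exact absurd h.symm (z_ne_f _ (Set.mem_Icc.2 ⟨by omega, j.2⟩) x)
    · exact congrArg Sum.inr (f_inj h)
  have L_mem : ∀ i, L i ∈ Set.Icc 1 (2 * p + Fintype.card X) := by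
    rintro (i | x)
    · exact z_mem _ (Set.mem_Icc.2 ⟨by omega, i.2⟩)
    · exact f_mem x
  have E_range : ∀ e, e ∈ G.edgeSet ↔ ∃ i, E i = e := by
    intro e
    constructor
    · induction e with | h u v => ?_
      intro huv
      rw [mem_edgeSet] at huv
      rcases vertex_cases u with ⟨i, hi, rfl⟩ | ⟨x, rfl⟩
      · rcases vertex_cases v with ⟨j, hj, rfl⟩ | ⟨y, rfl⟩
        · rcases (hadj i hi j hj).1 huv with rfl | rfl
          · exact ⟨Sum.inl ⟨i, by omega⟩, rfl⟩
          · exact ⟨Sum.inl ⟨j, by omega⟩, Sym2.eq_swap⟩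
        · refine ⟨Sum.inr y, ?_⟩
          rw [(hgadj y _).1 huv.symm]
          exact Sym2.eq_swap
      · refine ⟨Sum.inr x, ?_⟩
        rw [(hgadj x _).1 huv]
        rfl
    · rintro ⟨i | x, rfl⟩
      · exact (hadj _ i.2.le _ i.2).2 (Or.inl rfl)
      · exact (hgadj x _).2 rfl
  have edge_image : G.edgeFinset = univ.image E := by
    ext e
    rw [mem_edgeFinset, E_range]
    simp
  have cardV : Fintype.card V = 2 * p + 1 + Fintype.card X := by
    have h1 := Fintype.card_subtype_compl (fun x ↦ ∃ j ≤ 2 * p, W j = x)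
    have h2 : Fintype.card {x // ∃ j ≤ 2 * p, W j = x} = 2 * p + 1 := by
      rw [Fintype.card_subtype,
        show ({x | ∃ j ≤ 2 * p, W j = x} : Finset V) = (range (2 * p + 1)).image W from ?_,
        card_image_of_injOn, card_range]
      · intro i hi j hj
        simp only [coe_range, Set.mem_Iio] at hi hj
        exact W_inj i (by omega) j (by omega)
      · ext x
        simp
    have h3 : Fintype.card {x // ¬ ∃ j ≤ 2 * p, W j = x} = Fintype.card X :=
      Fintype.card_congr (Equiv.subtypeEquivRight fun x ↦ by push Not; rfl)
    have h4 := Fintype.card_subtype_le (fun x ↦ ∃ j ≤ 2 * p, W j = x)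
    omega
  let φ : Sym2 V → ℕ := Function.extend E L 0
  have φE : ∀ i, φ (E i) = L i := fun i ↦ E_inj.extend_apply _ _ _
  have total : ∀ u, ∑ e ∈ G.edgeFinset.filter (fun e => u ∈ e), φ e =
      (∑ i ∈ range (2 * p), if u ∈ s(W i, W (i + 1)) then z (i + 1) else 0) +
      ∑ x : X with u ∈ s(x.1, W (g x)), f x := by
    intro u
    rw [edge_image, filter_image, sum_image E_inj.injOn, sum_filter, Fintype.sum_sum_type,
      sum_filter, ← Fin.sum_univ_eq_sum_range
        (fun i ↦ if u ∈ s(W i, W (i + 1)) then z (i + 1) else 0)]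
    simp only [φE]
    rfl
  have total_path : ∀ j ≤ 2 * p, ∑ e ∈ G.edgeFinset.filter (fun e => W j ∈ e), φ e =
      z j + (if j < 2 * p then z (j + 1) else 0) + ∑ x with g x = j, f x := by
    intro j hj
    rw [total]
    congr 1
    · have h1 : ∀ i ∈ range (2 * p), (if W j ∈ s(W i, W (i + 1)) then z (i + 1) else 0) =
          (if i + 1 = j then z (i + 1) else 0) + (if i = j then z (i + 1) else 0) := by
        intro i hi
        simp only [mem_path i (mem_range.1 hi) j hj]
        split_ifs <;> omega
      rw [sum_congr rfl h1, sum_add_distrib, sum_ite_eq']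
      congr 1
      · rcases j with _ | j
        · simp [z0]
        · simp only [Nat.add_right_cancel_iff]
          rw [sum_ite_eq', if_pos (mem_range.2 hj)]
      · simp only [mem_range]
    · simp only [mem_pend _ j hj]
  have total_pend : ∀ x : X, ∑ e ∈ G.edgeFinset.filter (fun e => x.1 ∈ e), φ e = f x := by
    intro x
    rw [total, sum_eq_zero, zero_add]
    · simp only [mem_pend']
      rw [filter_eq' univ x]; simp
    · intro i hi
      rw [if_neg (mem_path' i (mem_range.1 hi) x)]
  have total_lt : ∀ j < 2 * p, ∑ e ∈ G.edgeFinset.filter (fun e => W j ∈ e), φ e =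
      z j + z (j + 1) + ∑ x with g x = j, f x := fun j hj ↦ by
    rw [total_path j hj.le, if_pos hj]
  have total_last : ∑ e ∈ G.edgeFinset.filter (fun e => W (2 * p) ∈ e), φ e = z (2 * p) := by
    rw [total_path _ le_rfl, if_neg (lt_irrefl _), sum_eq_zero]; · rfl
    intro x hx
    exact absurd (mem_filter.1 hx).2 (hg x).ne
  have last_mem : 2 * p ∈ Set.Icc 1 (2 * p) := Set.mem_Icc.2 ⟨by omega, le_rfl⟩
  refine ⟨φ, ⟨?_, ?_, ?_⟩, ?_⟩
  · intro e he
    obtain ⟨i, rfl⟩ := (E_range e).1 he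
    rw [φE, cardV]
    have := L_mem i
    simp only [Set.mem_Icc] at this ⊢
    omega
  · intro e he e' he' h
    obtain ⟨i, rfl⟩ := (E_range e).1 he
    obtain ⟨j, rfl⟩ := (E_range e').1 he'
    rw [φE, φE] at h
    rw [L_inj h]
  · intro m hm
    have h1 : univ.image L = Icc 1 (2 * p + Fintype.card X) := by
      refine eq_of_subset_of_card_le ?_ ?_
      · intro m hm
        obtain ⟨i, -, rfl⟩ := mem_image.1 hm
        exact mem_Icc.2 (L_mem i)
      · rw [card_image_of_injective _ L_inj]
        simp
    have h2 : m ∈ univ.image L := by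
      rw [h1, mem_Icc]
      rw [Set.mem_Icc, cardV] at hm
      omega
    obtain ⟨i, -, rfl⟩ := mem_image.1 h2
    exact ⟨E i, (E_range _).2 ⟨i, rfl⟩, φE i⟩
  · intro u v huv
    rcases vertex_cases u with ⟨i, hi, rfl⟩ | ⟨x, rfl⟩ <;>
      rcases vertex_cases v with ⟨j, hj, rfl⟩ | ⟨y, rfl⟩
    · have hij : i ≠ j := fun h ↦ huv (h ▸ rfl)
      rcases hi.lt_or_eq with hi | rfl <;> rcases hj.lt_or_eq with hj | rfl
      · rw [total_lt i hi, total_lt j hj]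
        exact fun h ↦ hij (tot_inj hi hj h)
      · rw [total_lt i hi, total_last]
        exact (tot_ne i hi).2
      · rw [total_lt j hj, total_last]
        exact (tot_ne j hj).2.symm
      · exact absurd rfl hij
    · rw [total_pend]
      rcases hi.lt_or_eq with hi | rfl
      · rw [total_lt i hi]; exact (tot_ne i hi).1 y
      · rw [total_last]; exact z_ne_f _ last_mem y
    · rw [total_pend]
      rcases hj.lt_or_eq with hj | rfl
      · rw [total_lt j hj]; exact ((tot_ne j hj).1 x).symm
      · rw [total_last]; exact (z_ne_f _ last_mem x).symm
    · rw [total_pend, total_pend]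
      exact fun h ↦ huv (congrArg Subtype.val (f_inj h))

/-- In a connected graph with at least three vertices, the neighbour of a vertex of degree one has
degree different from one. -/
lemma SimpleGraph.Connected.degree_ne_one_of_adj {V : Type*} [Fintype V] {G : SimpleGraph V}
    (hG : G.Connected) (hn : 3 ≤ Fintype.card V) {x y : V} (hx : G.degree x = 1)
    (hxy : G.Adj x y) : G.degree y ≠ 1 := by
  intro hy
  obtain ⟨a, -, ha⟩ := degree_eq_one_iff_existsUnique_adj.1 hx
  obtain ⟨b, -, hb⟩ := degree_eq_one_iff_existsUnique_adj.1 hy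
  have closed : ∀ u v, G.Adj u v → u = x ∨ u = y → v = x ∨ v = y := by
    rintro u v huv (rfl | rfl)
    · exact Or.inr ((ha v huv).trans (ha y hxy).symm)
    · exact Or.inl ((hb v huv).trans (hb x hxy.symm).symm)
  have all : ∀ v, v = x ∨ v = y := by
    intro v
    obtain ⟨q⟩ := hG.preconnected x v
    have : ∀ u v, G.Walk u v → u = x ∨ u = y → v = x ∨ v = y := by
      intro u v q
      induction q with
      | nil => exact id
      | cons h _ ih => exact fun hu ↦ ih (closed _ _ h hu)
    exact this x v q (Or.inl rfl)
  have h1 : (univ : Finset V) ⊆ {x, y} := fun v _ ↦ by simpa using all v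
  have h2 := (card_le_card h1).trans card_le_two
  rw [card_univ] at h2
  omega

/-- Every caterpillar is antimagic: if G is a tree of order n ≥ 3
whose non-leaf vertices induce a path (witnessed by an enumeration w of the
non-leaf vertices such that adjacency among them is exactly consecutiveness),
then there is a bijection φ : E(G) → {1,…,n−1} with pairwise distinct vertex
sums. -/
theorem stmt_10 {V : Type*} [Fintype V] (G : SimpleGraph V)
    (hn : 3 ≤ Fintype.card V) (htree : G.IsTree)
    (hcat : ∃ (k : ℕ) (w : Fin (k + 1) → V), Function.Injective w ∧
      (∀ x : V, x ∈ Set.range w ↔ G.degree x ≠ 1) ∧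
      (∀ i j : Fin (k + 1), G.Adj (w i) (w j) ↔
        ((i : ℕ) + 1 = (j : ℕ) ∨ (j : ℕ) + 1 = (i : ℕ)))) :
    ∃ φ : Sym2 V → ℕ,
      Set.BijOn φ G.edgeSet (Set.Icc 1 (Fintype.card V - 1)) ∧
      ∀ u v : V, u ≠ v →
        (∑ e ∈ G.edgeFinset.filter (fun e => u ∈ e), φ e) ≠
        (∑ e ∈ G.edgeFinset.filter (fun e => v ∈ e), φ e) := by
  obtain ⟨k, w, w_inj, w_range, w_adj⟩ := hcat
  have : Nontrivial V := Fintype.one_lt_card_iff_nontrivial.1 (by omega)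
  have pendant : ∀ x, x ∉ Set.range w → ∃ i, ∀ y, G.Adj x y ↔ y = w i := by
    intro x hx
    have hx1 : G.degree x = 1 := not_not.1 (mt (w_range x).2 hx)
    obtain ⟨a, hxa, ha⟩ := degree_eq_one_iff_existsUnique_adj.1 hx1
    obtain ⟨i, rfl⟩ := (w_range a).2 (htree.1.degree_ne_one_of_adj hn hx1 hxa)
    exact ⟨i, fun y ↦ ⟨ha y, fun h ↦ h ▸ hxa⟩⟩
  have exists_pendant : ∀ i u, (∀ j, G.Adj (w i) (w j) → w j = u) →
      ∃ x, x ∉ Set.range w ∧ x ≠ u ∧ ∀ y, G.Adj x y ↔ y = w i := by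
    intro i u hu
    have h1 : G.degree (w i) ≠ 1 := (w_range _).1 ⟨i, rfl⟩
    have h2 := htree.1.preconnected.degree_pos_of_nontrivial (w i)
    obtain ⟨x, hx, hxu⟩ := exists_mem_ne (s := G.neighborFinset (w i))
      (by rw [card_neighborFinset_eq_degree]; omega) u
    rw [mem_neighborFinset] at hx
    have hxw : x ∉ Set.range w := by
      rintro ⟨j, rfl⟩
      exact hxu (hu j hx)
    obtain ⟨a, ha⟩ := pendant x hxw
    refine ⟨x, hxw, hxu, ?_⟩
    rwa [(ha _).1 hx.symm]
  obtain ⟨l, l_notMem, -, l_adj⟩ := exists_pendant (Fin.last k) (w ⟨k - 1, by omega⟩) fun j hj ↦ by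
    congr 1
    have := (w_adj _ _).1 hj
    rw [Fin.val_last] at this
    exact Fin.ext (by change (j : ℕ) = k - 1; omega)
  obtain ⟨r, r_notMem, r_ne, r_adj⟩ : ∃ r, r ∉ Set.range w ∧ r ≠ l ∧ ∀ y, G.Adj r y ↔ y = w 0 := by
    rcases Nat.eq_zero_or_pos k with rfl | hk
    · exact exists_pendant 0 l fun j hj ↦ by
        obtain rfl : j = 0 := Fin.ext (by omega)
        exact absurd hj G.irrefl
    · obtain ⟨r, hr, -, hr'⟩ := exists_pendant 0 (w ⟨1, by omega⟩) fun j hj ↦ by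
        congr 1
        have := (w_adj _ _).1 hj
        rw [Fin.val_zero] at this
        exact Fin.ext (by change (j : ℕ) = 1; omega)
      refine ⟨r, hr, ?_, hr'⟩
      rintro rfl
      have := w_inj ((l_adj _).1 ((hr' _).2 rfl))
      rw [Fin.ext_iff, Fin.val_last, Fin.val_zero] at this
      omega
  let ω : ℕ → V := fun j ↦ if h : j < k + 1 then w ⟨j, h⟩ else l
  have ω_lt : ∀ j (h : j < k + 1), ω j = w ⟨j, h⟩ := fun j h ↦ dif_pos h
  have ω_last : ω (k + 1) = l := dif_neg (lt_irrefl _)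
  have ω_inj : ∀ i ≤ k + 1, ∀ j ≤ k + 1, ω i = ω j → i = j := by
    intro i hi j hj h
    rcases hi.lt_or_eq with hi | rfl <;> rcases hj.lt_or_eq with hj | rfl
    · rw [ω_lt i hi, ω_lt j hj] at h
      exact Fin.ext_iff.1 (w_inj h)
    · rw [ω_lt i hi, ω_last] at h
      exact absurd ⟨_, h⟩ l_notMem
    · rw [ω_lt j hj, ω_last] at h
      exact absurd ⟨_, h.symm⟩ l_notMem
    · rfl
  have l_adj_ω : ∀ j ≤ k + 1, G.Adj l (ω j) ↔ j = k := by
    intro j hj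
    rw [l_adj, show w (Fin.last k) = ω k from (ω_lt k (by omega)).symm]
    exact ⟨ω_inj j hj k (by omega), fun h ↦ h ▸ rfl⟩
  have r_adj_ω : ∀ j ≤ k + 1, G.Adj r (ω j) ↔ j = 0 := by
    intro j hj
    rw [r_adj, show w 0 = ω 0 from (ω_lt 0 (by omega)).symm]
    exact ⟨ω_inj j hj 0 (by omega), fun h ↦ h ▸ rfl⟩
  have ω_adj : ∀ i ≤ k + 1, ∀ j ≤ k + 1, G.Adj (ω i) (ω j) ↔ i + 1 = j ∨ j + 1 = i := by
    intro i hi j hj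
    rcases hi.lt_or_eq with hi | rfl
    · rcases hj.lt_or_eq with hj | rfl
      · rw [ω_lt i hi, ω_lt j hj, w_adj]
      · rw [ω_last, G.adj_comm, l_adj_ω i hi.le]
        omega
    · rw [ω_last, l_adj_ω j hj]
      omega
  have r_ne_ω : ∀ j ≤ k + 1, ω j ≠ r := by
    intro j hj h
    rcases hj.lt_or_eq with hj | rfl
    · exact r_notMem ⟨_, (ω_lt j hj).symm.trans h⟩
    · exact r_ne (h.symm.trans ω_last)
  have pendant_ω : ∀ x, (∀ j ≤ k + 1, ω j ≠ x) → ∃ j < k + 1, ∀ y, G.Adj x y ↔ y = ω j := by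
    intro x hx
    obtain ⟨i, hi⟩ := pendant x (by
      rintro ⟨i, rfl⟩
      exact hx i i.2.le (ω_lt i i.2))
    exact ⟨i, i.2, ω_lt i i.2 ▸ hi⟩
  obtain ⟨q, hq | hq⟩ := Nat.even_or_odd' (k + 1)
  · refine exists_antimagic_of_even_path G (p := q) (by omega) ω ?_ ?_ ?_ <;> rw [← hq]
    · exact fun i hi j hj ↦ ω_inj i hi j hj
    · exact ω_adj
    · exact pendant_ω
  · have hq' : 2 * (q + 1) = k + 1 + 1 := by omega
    refine exists_antimagic_of_even_path G (p := q + 1) (by omega)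
      (fun j ↦ j.casesOn r ω) ?_ ?_ ?_ <;> rw [hq']
    · rintro (_ | i) hi (_ | j) hj h
      · rfl
      · exact absurd h.symm (r_ne_ω j (Nat.le_of_succ_le_succ hj))
      · exact absurd h (r_ne_ω i (Nat.le_of_succ_le_succ hi))
      · exact congrArg _ (ω_inj i (Nat.le_of_succ_le_succ hi) j (Nat.le_of_succ_le_succ hj) h)
    · rintro (_ | i) hi (_ | j) hj
      · simp
      · refine (r_adj_ω j (by omega)).trans ?_
        omega
      · refine (G.adj_comm _ _).trans ((r_adj_ω i (by omega)).trans ?_)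
        omega
      · refine (ω_adj i (by omega) j (by omega)).trans ?_
        omega
    · intro x hx
      obtain ⟨j, hj, h⟩ := pendant_ω x fun j hj ↦ hx (j + 1) (by omega)
      exact ⟨j + 1, by omega, h⟩
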